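/- Let $(E,\|\cdot\|)$ be an ordered normed space, $M$ a positive uniformly bounded subset of $E$, and $\psi$ a linear functional on $E_M$ that is continuous for the $p_M$-norm and satisfies $\psi(m) = \|\psi\|_{op}$ for every $m \in M$, where $\|\psi\|_{op}$ denotes the operator norm of $\psi$ with respect to $p_M$. Then $\psi$ is positive on $E_M$. -/

import Mathlib

open scoped BigOperators

section MajorizedDefs

variable {E : Type*} [AddCommGroup E] [PartialOrder E] [Module ℝ E]

/-- `M` is a *positive subset* of the ordered vector space `E`: it is nonempty, contained in
the positive cone, and `0` does not belong to its convex hull. -/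
def IsPositiveSubset (M : Set E) : Prop :=
  M.Nonempty ∧ (∀ m ∈ M, 0 ≤ m) ∧ (0 : E) ∉ convexHull ℝ M

/-- The proper convex cone `C_M` generated by a positive subset `M`. -/
def coneGen (M : Set E) : Set E :=
  {c | ∃ (t : ℝ) (m : E), 0 ≤ t ∧ m ∈ convexHull ℝ M ∧ m ≠ 0 ∧ c = t • m}

/-- The majorized space `E_M`: all vectors `v` with `±v ≤ c` for some `c ∈ C_M`. -/
def EMaj (M : Set E) : Set E :=
  {v | ∃ c ∈ coneGen M, -v ≤ c ∧ v ≤ c}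

/-- The majorizing seminorm `p_M`. -/
noncomputable def pM (M : Set E) (v : E) : ℝ :=
  sInf {s : ℝ | ∃ (n : ℕ) (t : Fin n → ℝ) (m : Fin n → E),
    0 < n ∧ (∀ j, 0 ≤ t j) ∧ (∀ j, m j ∈ M) ∧
    (-v ≤ ∑ j, t j • m j) ∧ (v ≤ ∑ j, t j • m j) ∧ s = ∑ j, t j}

end MajorizedDefs

/-- Let `(E, ‖·‖)` be an ordered normed space, `M` a positive uniformly
bounded subset, and `ψ` a linear functional on `E_M` which is `p_M`-continuous and takes the
value `‖ψ‖_op` (its operator norm with respect to `p_M`) at every point of `M`. Then `ψ` is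
positive on `E_M`. -/
theorem pM_continuous_constant_functional_positive
    {E : Type*} [NormedAddCommGroup E] [PartialOrder E] [Module ℝ E]
    (hadd : ∀ x y z : E, x ≤ y → x + z ≤ y + z)
    (hsmul : ∀ (c : ℝ) (x y : E), 0 ≤ c → x ≤ y → c • x ≤ c • y)
    (hmono : ∀ x y : E, 0 ≤ x → x ≤ y → ‖x‖ ≤ ‖y‖)
    (hgen : ∀ v : E, ∃ x y : E, 0 ≤ x ∧ 0 ≤ y ∧ v = x - y)
    (M : Set E) (hM : IsPositiveSubset M)
    (hbdd : ∃ C : ℝ, ∀ m ∈ M, ‖m‖ ≤ C)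
    (ψ : E →ₗ[ℝ] ℝ)
    (hcont : ∃ K : ℝ, ∀ v ∈ EMaj M, |ψ v| ≤ K * pM M v)
    (hconst : ∀ m ∈ M, ψ m = sSup {r : ℝ | ∃ v ∈ EMaj M, pM M v ≤ 1 ∧ r = |ψ v|}) :
    ∀ v ∈ EMaj M, 0 ≤ v → 0 ≤ ψ v := by
  intro v hv hv0
  obtain ⟨c, ⟨t, m, ht, hm, hm0, rfl⟩, -, hvc⟩ := hv
  set N := sSup {r : ℝ | ∃ v ∈ EMaj M, pM M v ≤ 1 ∧ r = |ψ v|} with hN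
  have hnn : ∀ w : E, 0 ≤ pM M w := by
    intro w
    apply Real.sInf_nonneg
    rintro s ⟨n, t, m, -, ht, -, -, -, rfl⟩
    exact Finset.sum_nonneg fun j _ => ht j
  have hψm : ψ m = N := by
    have hc : Convex ℝ {x : E | ψ x = N} := by
      intro x hx y hy a b _ _ hab
      simp only [Set.mem_setOf_eq] at hx hy ⊢
      rw [map_add, map_smul, map_smul, hx, hy, ← add_smul, hab, one_smul]
    exact convexHull_min (fun x hx => hconst x hx) hc hm
  have hBdd : BddAbove {r : ℝ | ∃ v ∈ EMaj M, pM M v ≤ 1 ∧ r = |ψ v|} := by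
    obtain ⟨K, hK⟩ := hcont
    refine ⟨|K|, ?_⟩
    rintro r ⟨w, hw, hw1, rfl⟩
    calc |ψ w| ≤ K * pM M w := hK w hw
      _ ≤ |K| * pM M w := mul_le_mul_of_nonneg_right (le_abs_self K) (hnn w)
      _ ≤ |K| * 1 := mul_le_mul_of_nonneg_left hw1 (abs_nonneg K)
      _ = |K| := mul_one _
  rcases ht.eq_or_lt with rfl | ht
  · rw [zero_smul] at hvc
    rw [le_antisymm hvc hv0, map_zero]
  have hv1 : t⁻¹ • v ≤ m := by
    have := hsmul t⁻¹ _ _ (inv_nonneg.2 ht.le) hvc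
    rwa [smul_smul, inv_mul_cancel₀ ht.ne', one_smul] at this
  have hv2 : 0 ≤ t⁻¹ • v := by
    have := hsmul t⁻¹ _ _ (inv_nonneg.2 ht.le) hv0
    rwa [smul_zero] at this
  have hu0 : 0 ≤ m - t⁻¹ • v := by
    have := hadd _ _ (-(t⁻¹ • v)) hv1
    rwa [add_neg_cancel, ← sub_eq_add_neg] at this
  have hum : m - t⁻¹ • v ≤ m := by
    have := hadd _ _ (m - t⁻¹ • v) hv2
    rwa [zero_add, add_sub_cancel] at this
  have hun : -(m - t⁻¹ • v) ≤ m := by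
    have := hadd _ _ (-(m - t⁻¹ • v)) hu0
    rw [zero_add, add_neg_cancel] at this
    exact this.trans (hu0.trans hum)
  have huE : m - t⁻¹ • v ∈ EMaj M :=
    ⟨m, ⟨1, m, zero_le_one, hm, hm0, (one_smul _ _).symm⟩, hun, hum⟩
  have hu1 : pM M (m - t⁻¹ • v) ≤ 1 := by
    obtain ⟨ι, hι, w, z, hw0, hw1, hz, hwz⟩ := mem_convexHull_iff_exists_fintype.1 hm
    let e := Fintype.equivFin ι
    have hs : ∑ j, w (e.symm j) • z (e.symm j) = m := by
      rw [← hwz]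
      exact e.symm.sum_comp (fun i => w i • z i)
    apply csInf_le
    · refine ⟨0, ?_⟩
      rintro s ⟨n, t, m, -, ht, -, -, -, rfl⟩
      exact Finset.sum_nonneg fun j _ => ht j
    · refine ⟨Fintype.card ι, fun j => w (e.symm j), fun j => z (e.symm j), ?_,
        fun j => hw0 _, fun j => hz _, ?_, ?_, ?_⟩
      · rw [Fintype.card_pos_iff]
        by_contra h
        rw [not_nonempty_iff] at h
        simp at hw1
      · rw [hs]; exact hun
      · rw [hs]; exact hum
      · rw [← hw1]
        exact (e.symm.sum_comp w).symm
  have hle : |ψ (m - t⁻¹ • v)| ≤ N := le_csSup hBdd ⟨_, huE, hu1, rfl⟩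
  have h2 := (le_abs_self _).trans hle
  rw [map_sub, map_smul, hψm, smul_eq_mul] at h2
  have h3 : 0 ≤ t⁻¹ * ψ v := by linarith
  exact nonneg_of_mul_nonneg_right h3 (inv_pos.2 ht)
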